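/- In the lattice L = U ⊕ U ⊕ U ⊕ E8 ⊕ E8 ⊕ ⟨−2⟩, let (e,f) be the standard basis of the first U-factor and set w = e + 23f. Then w is a primitive vector with ⟨w,w⟩ = 46, and the orthogonal complement w^⊥ = {x ∈ L : ⟨x,w⟩ = 0}, with the restricted bilinear form, is isometric to the lattice E8 ⊕ E8 ⊕ U ⊕ ⟨−2⟩ ⊕ ⟨2⟩ ⊕ K₂₃. -/

import Mathlib

open Matrix

/-- Gram matrix of the hyperbolic plane `U`. -/
def latU : Matrix (Fin 2) (Fin 2) ℤ := !![0, 1; 1, 0]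

/-- Gram matrix of the negative definite `E8` lattice (diagonal `-2`, entry `1` for
vertices adjacent in the `E8` Dynkin diagram). -/
def latE8 : Matrix (Fin 8) (Fin 8) ℤ :=
  !![-2,  0,  1,  0,  0,  0,  0,  0;
      0, -2,  0,  1,  0,  0,  0,  0;
      1,  0, -2,  1,  0,  0,  0,  0;
      0,  1,  1, -2,  1,  0,  0,  0;
      0,  0,  0,  1, -2,  1,  0,  0;
      0,  0,  0,  0,  1, -2,  1,  0;
      0,  0,  0,  0,  0,  1, -2,  1;
      0,  0,  0,  0,  0,  0,  1, -2]

/-- Gram matrix of the lattice `K₂₃`. -/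
def latK23 : Matrix (Fin 2) (Fin 2) ℤ := !![-12, 1; 1, -2]

/-- Reindexing equivalence used to assemble the Gram matrix of `L`.
The standard basis `(e, f)` of the first `U`-factor sits at indices `0, 1`. -/
def eqL : (((((Fin 2 ⊕ Fin 2) ⊕ Fin 2) ⊕ Fin 8) ⊕ Fin 8) ⊕ Fin 1) ≃ Fin 23 :=
  (Equiv.sumCongr
    ((Equiv.sumCongr
      ((Equiv.sumCongr
        ((Equiv.sumCongr finSumFinEquiv (Equiv.refl (Fin 2))).trans finSumFinEquiv)
        (Equiv.refl (Fin 8))).trans finSumFinEquiv)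
      (Equiv.refl (Fin 8))).trans finSumFinEquiv)
    (Equiv.refl (Fin 1))).trans finSumFinEquiv

/-- Gram matrix of the lattice `L = U ⊕ U ⊕ U ⊕ E8 ⊕ E8 ⊕ ⟨-2⟩` of signature `(3, 20)`. -/
def gramL : Matrix (Fin 23) (Fin 23) ℤ :=
  Matrix.reindex eqL eqL
    (Matrix.fromBlocks
      (Matrix.fromBlocks
        (Matrix.fromBlocks
          (Matrix.fromBlocks (Matrix.fromBlocks latU 0 0 latU) 0 0 latU) 0 0 latE8)
        0 0 latE8)
      0 0 !![-2])

/-- Reindexing equivalence used to assemble the Gram matrix of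
`E8 ⊕ E8 ⊕ U ⊕ ⟨-2⟩ ⊕ ⟨2⟩ ⊕ K₂₃`. -/
def eqW : (((((Fin 8 ⊕ Fin 8) ⊕ Fin 2) ⊕ Fin 1) ⊕ Fin 1) ⊕ Fin 2) ≃ Fin 22 :=
  (Equiv.sumCongr
    ((Equiv.sumCongr
      ((Equiv.sumCongr
        ((Equiv.sumCongr finSumFinEquiv (Equiv.refl (Fin 2))).trans finSumFinEquiv)
        (Equiv.refl (Fin 1))).trans finSumFinEquiv)
      (Equiv.refl (Fin 1))).trans finSumFinEquiv)
    (Equiv.refl (Fin 2))).trans finSumFinEquiv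

/-- Gram matrix of the lattice `E8 ⊕ E8 ⊕ U ⊕ ⟨-2⟩ ⊕ ⟨2⟩ ⊕ K₂₃`. -/
def gramW : Matrix (Fin 22) (Fin 22) ℤ :=
  Matrix.reindex eqW eqW
    (Matrix.fromBlocks
      (Matrix.fromBlocks
        (Matrix.fromBlocks
          (Matrix.fromBlocks (Matrix.fromBlocks latE8 0 0 latE8) 0 0 latU) 0 0 !![-2])
        0 0 !![2])
      0 0 latK23)

/-- The vector `w = e + 23f` in `L`. -/
def vecW : Fin 23 → ℤ := fun i => if i = 0 then 1 else if i = 1 then 23 else 0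

/-- A basis of the orthogonal complement of `e + 23f`, as the rows of a matrix. Writing
`g = e - 23f` and `(u, v)` for the standard basis of the second `U`-factor, the last three rows
`g + 2u + 12v`, `-u + 6v` and `g + 2u + 11v` span `⟨2⟩ ⊕ K₂₃`; the others are standard basis
vectors of `L`. -/
def orthBasis : Matrix (Fin 22) (Fin 23) ℤ := fun i =>
  if i < 16 then Pi.single (i.castSucc + 6) 1
  else if i = 16 then Pi.single 4 1
  else if i = 17 then Pi.single 5 1
  else if i = 18 then Pi.single 22 1
  else if i = 19 then Pi.single 0 1 + Pi.single 1 (-23) + Pi.single 2 2 + Pi.single 3 12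
  else if i = 20 then Pi.single 2 (-1) + Pi.single 3 6
  else Pi.single 0 1 + Pi.single 1 (-23) + Pi.single 2 2 + Pi.single 3 11

/-- The matrix whose columns are the coordinate functionals with respect to `orthBasis`. -/
def orthCoord : Matrix (Fin 23) (Fin 22) ℤ := fun k i =>
  if i < 16 then (Pi.single (i.castSucc + 6) 1 : Fin 23 → ℤ) k
  else if i = 16 then (Pi.single 4 1 : Fin 23 → ℤ) k
  else if i = 17 then (Pi.single 5 1 : Fin 23 → ℤ) k
  else if i = 18 then (Pi.single 22 1 : Fin 23 → ℤ) k
  else if i = 19 then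
    (Pi.single 0 (-23) + Pi.single 2 6 + Pi.single 3 1 : Fin 23 → ℤ) k
  else if i = 20 then (Pi.single 0 2 + Pi.single 2 (-1) : Fin 23 → ℤ) k
  else (Pi.single 0 24 + Pi.single 2 (-6) + Pi.single 3 (-1) : Fin 23 → ℤ) k

theorem vecW_dotProduct_gramL_mulVec_vecW : vecW ⬝ᵥ gramL.mulVec vecW = 46 := by
  decide +kernel

theorem orthBasis_mul_gramL_mul_transpose :
    orthBasis * (gramL * orthBasisᵀ) = gramW := by
  decide +kernel

theorem vecW_orthogonal_orthBasis (i : Fin 22) :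
    vecW ⬝ᵥ gramL.mulVec (orthBasis i) = 0 := by
  revert i
  decide +kernel

theorem orthBasis_mul_orthCoord : orthBasis * orthCoord = 1 := by
  decide +kernel

/-- `orthBasis` and `orthCoord` are inverse up to a rank-one term vanishing on `w^⊥`. -/
theorem orthCoord_mul_orthBasis :
    orthCoord * orthBasis + vecMulVec (vecW ᵥ* gramL) (Pi.single 1 1) = 1 := by
  decide +kernel

theorem vecMul_orthCoord_vecMul_orthBasis {x : Fin 23 → ℤ}
    (hx : vecW ⬝ᵥ gramL.mulVec x = 0) : (x ᵥ* orthCoord) ᵥ* orthBasis = x := by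
  have h := congrArg (x ᵥ* ·) orthCoord_mul_orthBasis
  rw [dotProduct_mulVec, dotProduct_comm] at hx
  simpa [vecMul_add, vecMul_vecMulVec, hx] using h

/-- In `L = U ⊕ U ⊕ U ⊕ E8 ⊕ E8 ⊕ ⟨-2⟩`, the vector `w = e + 23f` is
primitive of square `46`, and its orthogonal complement is isometric to
`E8 ⊕ E8 ⊕ U ⊕ ⟨-2⟩ ⊕ ⟨2⟩ ⊕ K₂₃`. -/
theorem stmt15 :
    (∀ (m : ℤ) (w : Fin 23 → ℤ), vecW = m • w → IsUnit m) ∧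
    vecW ⬝ᵥ gramL.mulVec vecW = 46 ∧
    ∃ b : Fin 22 → (Fin 23 → ℤ),
      (∀ i, vecW ⬝ᵥ gramL.mulVec (b i) = 0) ∧
      (∀ x : Fin 23 → ℤ, vecW ⬝ᵥ gramL.mulVec x = 0 ↔
        ∃ c : Fin 22 → ℤ, x = ∑ i, c i • b i) ∧
      (∀ c : Fin 22 → ℤ, ∑ i, c i • b i = 0 → c = 0) ∧
      (∀ i j, b i ⬝ᵥ gramL.mulVec (b j) = gramW i j) := by
  refine ⟨fun m w h => ?_, vecW_dotProduct_gramL_mulVec_vecW, orthBasis,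
    vecW_orthogonal_orthBasis, fun x => ⟨fun hx => ⟨x ᵥ* orthCoord, ?_⟩, ?_⟩, fun c hc => ?_,
    fun i j => congrFun₂ orthBasis_mul_gramL_mul_transpose i j⟩
  · exact .of_mul_eq_one (w 0) (congrFun h 0).symm
  · rw [← vecMul_eq_sum, vecMul_orthCoord_vecMul_orthBasis hx]
  · rintro ⟨c, rfl⟩
    simp [-zsmul_eq_mul, mulVec_sum, mulVec_smul, dotProduct_sum, dotProduct_smul, vecW_orthogonal_orthBasis]
  · rw [← vecMul_eq_sum] at hc
    rw [← vecMul_one c, ← orthBasis_mul_orthCoord, ← vecMul_vecMul, hc, zero_vecMul]
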